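/- Let Ω ⊂ ℝⁿ be compact and convex, p ∈ (0,1] and β > 0, and let q̄ ∈ C(Ω). Then (i) max { ∫_Ω q̄ dμ : μ ∈ M(Ω), |μ|(Ω) ≤ 1 } = max_{x ∈ Ω} |q̄(x)|, and (ii) max { ∫_Ω q̄ dν : ν ∈ M(Ω), ν(Ω) = 0, W_p(ν⁺, ν⁻) + (β/2)|ν|(Ω) ≤ 1 } = max_{(x,y) ∈ Ω × Ω} (q̄(x) − q̄(y))/(|x−y|^p + β). -/

import Mathlib

open MeasureTheory ENNReal

noncomputable section

variable {X : Type*} [MeasurableSpace X]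

/-- Couplings (transport plans) between two nonnegative measures. -/
def couplings (ρ₁ ρ₂ : Measure X) : Set (Measure (X × X)) :=
  {γ | γ.map Prod.fst = ρ₁ ∧ γ.map Prod.snd = ρ₂}

/-- The transport cost of a plan for the cost `|x-y|^p`. -/
def transportCost [PseudoMetricSpace X] (p : ℝ) (γ : Measure (X × X)) : ℝ≥0∞ :=
  ∫⁻ z, ENNReal.ofReal (dist z.1 z.2 ^ p) ∂γ

/-- The `p`-Wasserstein cost `W_p` (no `1/p`-th power is taken); it is `∞` if
there is no coupling. -/
def W [PseudoMetricSpace X] (p : ℝ) (ρ₁ ρ₂ : Measure X) : ℝ≥0∞ :=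
  ⨅ (γ : Measure (X × X)) (_ : γ ∈ couplings ρ₁ ρ₂), transportCost p γ

/-- Positive part `μ⁺` of the Hahn-Jordan decomposition. -/
def pos (μ : SignedMeasure X) : Measure X := μ.toJordanDecomposition.posPart

/-- Negative part `μ⁻` of the Hahn-Jordan decomposition. -/
def neg (μ : SignedMeasure X) : Measure X := μ.toJordanDecomposition.negPart

/-- Total variation `|μ|(Ω)`. -/
def tv (μ : SignedMeasure X) : ℝ≥0∞ := μ.totalVariation Set.univ

/-- The generalized Kantorovich-Rubinstein norm `‖μ‖_{KR_p^{α,β}}`. -/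
def KRnorm [PseudoMetricSpace X] (p α β : ℝ) (μ : SignedMeasure X) : ℝ≥0∞ :=
  ⨅ (ν : SignedMeasure X) (_ : ν Set.univ = 0),
    W p (pos ν) (neg ν) + ENNReal.ofReal (β / 2) * tv ν + ENNReal.ofReal α * tv (μ - ν)

/-- Dirac delta `δ_x` as a signed measure. -/
def sDirac (x : X) : SignedMeasure X := (Measure.dirac x).toSignedMeasure

/-- Duality pairing `∫ q dμ` of a continuous function against a signed measure. -/
def pairing [TopologicalSpace X] (q : C(X, ℝ)) (μ : SignedMeasure X) : ℝ :=
  ∫ x, q x ∂(pos μ) - ∫ x, q x ∂(neg μ)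

/-- The weak* topology on signed measures, induced by testing against `C₀` functions. -/
def weakStar (X : Type*) [MeasurableSpace X] [TopologicalSpace X] :
    TopologicalSpace (SignedMeasure X) :=
  TopologicalSpace.induced
    (fun μ => fun f : ZeroAtInftyContinuousMap X ℝ =>
      ∫ x, f x ∂(pos μ) - ∫ x, f x ∂(neg μ))
    Pi.topologicalSpace

/-- Support of a nonnegative measure. -/
def msupport [TopologicalSpace X] (μ : Measure X) : Set X :=
  {x | ∀ U : Set X, IsOpen U → x ∈ U → μ U ≠ 0}

end

section LinearMaxima

theorem continuous_dist_rpow {X : Type*} [PseudoMetricSpace X] {p : ℝ} (hp : 0 < p) :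
    Continuous fun z : X × X => dist z.1 z.2 ^ p :=
  continuous_dist.rpow_const fun _ => Or.inr hp.le

variable {X : Type*} [MeasurableSpace X]

instance (μ : SignedMeasure X) : IsFiniteMeasure (pos μ) :=
  μ.toJordanDecomposition.posPart_finite

instance (μ : SignedMeasure X) : IsFiniteMeasure (neg μ) :=
  μ.toJordanDecomposition.negPart_finite

theorem pos_jordan (j : JordanDecomposition X) : pos j.toSignedMeasure = j.posPart := by
  rw [pos, JordanDecomposition.toJordanDecomposition_toSignedMeasure]

theorem neg_jordan (j : JordanDecomposition X) : neg j.toSignedMeasure = j.negPart := by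
  rw [neg, JordanDecomposition.toJordanDecomposition_toSignedMeasure]

theorem tv_eq (μ : SignedMeasure X) : tv μ = pos μ Set.univ + neg μ Set.univ := rfl

theorem integrable_of_continuous {Y : Type*} [TopologicalSpace Y] [CompactSpace Y]
    [MeasurableSpace Y] [OpensMeasurableSpace Y]
    (μ : Measure Y) [IsFiniteMeasure μ] {f : Y → ℝ} (hf : Continuous f) : Integrable f μ :=
  hf.integrable_of_hasCompactSupport (.of_compactSpace f)

theorem pairing_le_of_tv_le_one [TopologicalSpace X] (q : C(X, ℝ)) {M : ℝ} (hM₀ : 0 ≤ M)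
    (hM : ∀ x, |q x| ≤ M) {μ : SignedMeasure X} (hμ : tv μ ≤ 1) : pairing q μ ≤ M := by
  have bound (ρ : Measure X) [IsFiniteMeasure ρ] : |∫ x, q x ∂ρ| ≤ M * ρ.real Set.univ := by
    rw [← Real.norm_eq_abs]
    exact norm_integral_le_of_norm_le_const (Filter.Eventually.of_forall hM)
  have hmass : (pos μ).real Set.univ + (neg μ).real Set.univ ≤ 1 := by
    rw [measureReal_def, measureReal_def,
      ← ENNReal.toReal_add (measure_ne_top _ _) (measure_ne_top _ _), ← tv_eq]
    exact ENNReal.toReal_le_of_le_ofReal zero_le_one (by simpa using hμ)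
  have h₁ := (abs_le.1 (bound (pos μ))).2
  have h₂ := (abs_le.1 (bound (neg μ))).1
  unfold pairing
  nlinarith

variable [MetricSpace X] [CompactSpace X] [BorelSpace X]

theorem pairing_le_of_coupling (q : C(X, ℝ)) {p β m : ℝ} (hp : 0 < p) (hβ : 0 < β)
    (hm₀ : 0 ≤ m) (hm : ∀ z : X × X, q z.1 - q z.2 ≤ m * (dist z.1 z.2 ^ p + β))
    {ν : SignedMeasure X} {γ : Measure (X × X)} (hγ : γ ∈ couplings (pos ν) (neg ν)) {K : ℝ}
    (hK : 0 ≤ K) (hcost : transportCost p γ + ENNReal.ofReal (β / 2) * tv ν ≤ ENNReal.ofReal K) :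
    pairing q ν ≤ K * m := by
  obtain ⟨hfst, hsnd⟩ := hγ
  have mass_fst : pos ν Set.univ = γ Set.univ := by
    rw [← hfst, Measure.map_apply measurable_fst .univ, Set.preimage_univ]
  have mass_snd : neg ν Set.univ = γ Set.univ := by
    rw [← hsnd, Measure.map_apply measurable_snd .univ, Set.preimage_univ]
  have : IsFiniteMeasure γ := ⟨by rw [← mass_fst]; exact measure_lt_top _ _⟩
  have hdist := integrable_of_continuous γ (continuous_dist_rpow (X := X) hp)
  have hq₁ : Integrable (fun z : X × X => q z.1) γ :=
    integrable_of_continuous γ (by fun_prop)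
  have hq₂ : Integrable (fun z : X × X => q z.2) γ :=
    integrable_of_continuous γ (by fun_prop)
  have hpair : pairing q ν = ∫ z, (q z.1 - q z.2) ∂γ := by
    rw [pairing, ← hfst, ← hsnd, integral_map measurable_fst.aemeasurable
      q.continuous.aestronglyMeasurable, integral_map measurable_snd.aemeasurable
      q.continuous.aestronglyMeasurable, integral_sub hq₁ hq₂]
  have hmass : γ.real Set.univ = (γ Set.univ).toReal := rfl
  have htv : ENNReal.ofReal (β / 2) * tv ν = ENNReal.ofReal (β * γ.real Set.univ) := by
    rw [tv_eq, mass_fst, mass_snd, ← two_mul, ← mul_assoc, ENNReal.ofReal_mul hβ.le,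
      ofReal_measureReal, ← ENNReal.ofReal_ofNat 2, ← ENNReal.ofReal_mul (by positivity),
      div_mul_cancel₀ β two_ne_zero]
  have hint : 0 ≤ ∫ z : X × X, dist z.1 z.2 ^ p ∂γ :=
    integral_nonneg fun z => Real.rpow_nonneg dist_nonneg p
  have hcost' : (∫ z : X × X, dist z.1 z.2 ^ p ∂γ) + β * γ.real Set.univ ≤ K := by
    rw [htv, transportCost, ← ofReal_integral_eq_lintegral_ofReal hdist
      (Filter.Eventually.of_forall fun z => Real.rpow_nonneg dist_nonneg p),
      ← ENNReal.ofReal_add hint (by positivity)] at hcost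
    exact (ENNReal.ofReal_le_ofReal_iff hK).1 hcost
  calc pairing q ν = ∫ z, (q z.1 - q z.2) ∂γ := hpair
    _ ≤ ∫ z : X × X, m * (dist z.1 z.2 ^ p + β) ∂γ :=
      integral_mono (hq₁.sub hq₂) ((hdist.add (integrable_const β)).const_mul m) hm
    _ = m * ((∫ z : X × X, dist z.1 z.2 ^ p ∂γ) + β * γ.real Set.univ) := by
      rw [integral_const_mul, integral_add hdist (integrable_const β), integral_const,
        smul_eq_mul, mul_comm β]
    _ ≤ K * m := by rw [mul_comm K]; gcongr

theorem pairing_le_of_W_add_tv_le_one (q : C(X, ℝ)) {p β m : ℝ} (hp : 0 < p) (hβ : 0 < β)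
    (hm₀ : 0 ≤ m) (hm : ∀ z : X × X, q z.1 - q z.2 ≤ m * (dist z.1 z.2 ^ p + β))
    {ν : SignedMeasure X}
    (hν : W p (pos ν) (neg ν) + ENNReal.ofReal (β / 2) * tv ν ≤ 1) : pairing q ν ≤ m := by
  have hlim : Filter.Tendsto (fun K : ℝ => K * m) (nhdsWithin 1 (Set.Ioi 1)) (nhds m) := by
    have : Continuous fun K : ℝ => K * m := by fun_prop
    simpa using (this.tendsto 1).mono_left nhdsWithin_le_nhds
  refine ge_of_tendsto hlim ?_
  filter_upwards [self_mem_nhdsWithin] with K hK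
  have hK' : (1 : ℝ) < K := hK
  have hlt : W p (pos ν) (neg ν) + ENNReal.ofReal (β / 2) * tv ν < ENNReal.ofReal K :=
    hν.trans_lt (by simpa using hK')
  simp only [W, ENNReal.iInf_add, iInf_lt_iff] at hlt
  obtain ⟨γ, hγ, hlt⟩ := hlt
  exact pairing_le_of_coupling q hp hβ hm₀ hm hγ (by linarith) hlt.le

theorem exists_tv_le_one_pairing_eq_abs (q : C(X, ℝ)) (x : X) :
    ∃ μ : SignedMeasure X, tv μ ≤ 1 ∧ |q x| = pairing q μ := by
  rcases le_total 0 (q x) with h | h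
  · refine ⟨JordanDecomposition.toSignedMeasure
      ⟨Measure.dirac x, 0, .zero_right⟩, ?_, ?_⟩
    · simp [tv_eq, pos_jordan, neg_jordan]
    · simp [pairing, pos_jordan, neg_jordan, abs_of_nonneg h]
  · refine ⟨JordanDecomposition.toSignedMeasure
      ⟨0, Measure.dirac x, .zero_left⟩, ?_, ?_⟩
    · simp [tv_eq, pos_jordan, neg_jordan]
    · simp [pairing, pos_jordan, neg_jordan, abs_of_nonpos h]

theorem exists_dipole_pairing_eq (q : C(X, ℝ)) {p β : ℝ} (hβ : 0 < β) {x y : X} (hxy : x ≠ y) :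
    ∃ ν : SignedMeasure X, ν Set.univ = 0 ∧
      W p (pos ν) (neg ν) + ENNReal.ofReal (β / 2) * tv ν ≤ 1 ∧
      (q x - q y) / (dist x y ^ p + β) = pairing q ν := by
  have hd : 0 ≤ dist x y ^ p := Real.rpow_nonneg dist_nonneg p
  have hpos : 0 < dist x y ^ p + β := by positivity
  set c : NNReal := (dist x y ^ p + β)⁻¹.toNNReal with hc
  have hc' : (c : ℝ) = (dist x y ^ p + β)⁻¹ := Real.coe_toNNReal _ (by positivity)
  have hsing : Measure.MutuallySingular (c • Measure.dirac x) (c • Measure.dirac y) :=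
    .mk (s := {y}) (t := {y}ᶜ) (by simp [hxy]) (by simp) (by simp)
  let j : JordanDecomposition X := ⟨c • Measure.dirac x, c • Measure.dirac y, hsing⟩
  refine ⟨j.toSignedMeasure, ?_, ?_, ?_⟩
  · simp [JordanDecomposition.toSignedMeasure, j]
  · have hγ : c • Measure.dirac (x, y) ∈ couplings (pos j.toSignedMeasure)
        (neg j.toSignedMeasure) := by
      rw [pos_jordan, neg_jordan]
      constructor
      · rw [Measure.map_smul, Measure.map_dirac' measurable_fst]
      · rw [Measure.map_smul, Measure.map_dirac' measurable_snd]
    have hcost : transportCost p (c • Measure.dirac (x, y)) =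
        ENNReal.ofReal (c * dist x y ^ p) := by
      rw [transportCost, lintegral_smul_measure, lintegral_dirac,
        ENNReal.ofReal_mul c.coe_nonneg, ENNReal.ofReal_coe_nnreal]
      rfl
    have htv : tv j.toSignedMeasure = ENNReal.ofReal (2 * c) := by
      rw [tv_eq, pos_jordan, neg_jordan, two_mul,
        ENNReal.ofReal_add c.coe_nonneg c.coe_nonneg, ENNReal.ofReal_coe_nnreal]
      simp [j]
    calc _ ≤ ENNReal.ofReal (c * dist x y ^ p) + ENNReal.ofReal (β / 2) * _ := by
          rw [← hcost]; gcongr; exact iInf₂_le _ hγ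
      _ = ENNReal.ofReal (c * dist x y ^ p + β / 2 * (2 * c)) := by
          rw [htv, ← ENNReal.ofReal_mul (by positivity),
            ← ENNReal.ofReal_add (by positivity) (by positivity)]
      _ = 1 := by
          rw [← ENNReal.ofReal_one]
          congr 1
          rw [hc']
          field_simp
      _ ≤ 1 := le_rfl
  · rw [pairing, pos_jordan, neg_jordan, integral_smul_nnreal_measure,
      integral_smul_nnreal_measure, integral_dirac, integral_dirac]
    simp only [NNReal.smul_def, hc', smul_eq_mul]
    ring

theorem exists_balanced_pairing_eq (q : C(X, ℝ)) {p β : ℝ} (hβ : 0 < β) (z : X × X) :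
    ∃ ν : SignedMeasure X, ν Set.univ = 0 ∧
      W p (pos ν) (neg ν) + ENNReal.ofReal (β / 2) * tv ν ≤ 1 ∧
      (q z.1 - q z.2) / (dist z.1 z.2 ^ p + β) = pairing q ν := by
  by_cases hz : z.1 = z.2
  · have hpos : pos (0 : SignedMeasure X) = 0 := by
      simp [pos, SignedMeasure.toJordanDecomposition_zero]
    have hneg : neg (0 : SignedMeasure X) = 0 := by
      simp [neg, SignedMeasure.toJordanDecomposition_zero]
    have hW : W p (0 : Measure X) 0 ≤ 0 :=
      (iInf₂_le 0 (by simp [couplings])).trans (by simp [transportCost])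
    refine ⟨0, by simp, ?_, ?_⟩
    · rw [tv_eq, hpos, hneg, nonpos_iff_eq_zero.1 hW]
      simp
    · simp [pairing, hpos, hneg, hz]
  · exact exists_dipole_pairing_eq q hβ hz

end LinearMaxima

/-- maxima of a linear functional over the TV unit ball and over the
mass-penalized transport ball. -/
theorem max_linear_over_balls {n : ℕ} (Ω : Set (EuclideanSpace ℝ (Fin n)))
    (hΩc : IsCompact Ω) (hΩ : Convex ℝ Ω) (hne : Ω.Nonempty)
    (p β : ℝ) (hp0 : 0 < p) (hp1 : p ≤ 1) (hβ : 0 < β) (q : C(↥Ω, ℝ)) :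
    (∃ m : ℝ,
        IsGreatest {r : ℝ | ∃ μ : SignedMeasure ↥Ω, tv μ ≤ 1 ∧ r = pairing q μ} m ∧
        IsGreatest {r : ℝ | ∃ x : ↥Ω, r = |q x|} m) ∧
    (∃ m : ℝ,
        IsGreatest {r : ℝ | ∃ ν : SignedMeasure ↥Ω, ν Set.univ = 0 ∧
            W p (pos ν) (neg ν) + ENNReal.ofReal (β / 2) * tv ν ≤ 1 ∧
            r = pairing q ν} m ∧
        IsGreatest
          {r : ℝ | ∃ z : ↥Ω × ↥Ω, r = (q z.1 - q z.2) / (dist z.1 z.2 ^ p + β)} m) := by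
  have : CompactSpace Ω := isCompact_iff_compactSpace.1 hΩc
  have : Nonempty Ω := hne.to_subtype
  constructor
  · obtain ⟨x, hx⟩ := (continuous_abs.comp q.continuous).exists_forall_ge_of_hasCompactSupport
      (HasCompactSupport.of_compactSpace _)
    refine ⟨|q x|, ⟨exists_tv_le_one_pairing_eq_abs q x, ?_⟩, ⟨x, rfl⟩, ?_⟩
    · rintro _ ⟨μ, hμ, rfl⟩
      exact pairing_le_of_tv_le_one q (abs_nonneg _) hx hμ
    · rintro _ ⟨y, rfl⟩
      exact hx y
  · have hden (z : Ω × Ω) : 0 < dist z.1 z.2 ^ p + β :=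
      add_pos_of_nonneg_of_pos (Real.rpow_nonneg dist_nonneg p) hβ
    have hcont : Continuous fun z : Ω × Ω => (q z.1 - q z.2) / (dist z.1 z.2 ^ p + β) :=
      Continuous.div (by fun_prop) ((continuous_dist_rpow hp0).add continuous_const)
        fun z => (hden z).ne'
    obtain ⟨z, hz⟩ := hcont.exists_forall_ge_of_hasCompactSupport
      (HasCompactSupport.of_compactSpace _)
    refine ⟨_, ⟨exists_balanced_pairing_eq q hβ z, ?_⟩, ⟨z, rfl⟩, ?_⟩
    · rintro _ ⟨ν, -, hν, rfl⟩
      refine pairing_le_of_W_add_tv_le_one q hp0 hβ ?_ (fun w => ?_) hν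
      · simpa using hz (z.1, z.1)
      · exact (div_le_iff₀ (hden w)).1 (hz w)
    · rintro _ ⟨w, rfl⟩
      exact hz w
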